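/- If K is a hyperfocused k-arc in PG(2,q) with k ≥ 4 and K is not contained in a hyperoval, then k ≤ q/2. -/

import Mathlib

open scoped LinearAlgebra.Projectivization

/-- The projective plane over a field `F`. -/
abbrev PG2 (F : Type*) [Field F] := Projectivization F (Fin 3 → F)

variable {F : Type*} [Field F]

/-- A line of `PG2 F`: the zero set of a nonzero linear form. -/
def IsLine (l : Set (PG2 F)) : Prop :=
  ∃ f : (Fin 3 → F) →ₗ[F] F, f ≠ 0 ∧ l = {P : PG2 F | f P.rep = 0}

/-- Three points of `PG2 F` are collinear if some line contains them all. -/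
def Collinear3 (A B C : PG2 F) : Prop :=
  ∃ l : Set (PG2 F), IsLine l ∧ A ∈ l ∧ B ∈ l ∧ C ∈ l

/-- An arc: a set of points no three of which are collinear, i.e. every line
meets it in at most two points. -/
def IsArc (K : Set (PG2 F)) : Prop :=
  ∀ l : Set (PG2 F), IsLine l → (K ∩ l).ncard ≤ 2

/-- A secant (chord) of `K`: a line containing at least two points of `K`. -/
def IsSecant (K l : Set (PG2 F)) : Prop :=
  IsLine l ∧ 2 ≤ (K ∩ l).ncard

/-- A blocking set of the secants of `K`: a set of points disjoint from `K`
meeting every secant of `K`. -/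
def IsBlockingSet (K B : Set (PG2 F)) : Prop :=
  B ∩ K = ∅ ∧ ∀ l : Set (PG2 F), IsSecant K l → (B ∩ l).Nonempty

/-- The focus set of `K` on `l`: the points of `l` lying on some secant of `K`. -/
def FocusSet (K l : Set (PG2 F)) : Set (PG2 F) :=
  {P : PG2 F | P ∈ l ∧ ∃ m : Set (PG2 F), IsSecant K m ∧ P ∈ m}

/-- `K` is hyperfocused on the exterior line `l` if the secants of `K` meet `l`
in exactly `|K| - 1` points. -/
def Hyperfocused (K l : Set (PG2 F)) : Prop :=
  IsLine l ∧ K ∩ l = ∅ ∧ (FocusSet K l).ncard = K.ncard - 1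

/-- `K` is sharply focused on the exterior line `l` if the secants of `K` meet `l`
in exactly `|K|` points. -/
def SharplyFocused (K l : Set (PG2 F)) : Prop :=
  IsLine l ∧ K ∩ l = ∅ ∧ (FocusSet K l).ncard = K.ncard

/-- A conic: the zero set of an irreducible homogeneous quadratic form. -/
def IsConic (C : Set (PG2 F)) : Prop :=
  ∃ Q : MvPolynomial (Fin 3) F, Q.IsHomogeneous 2 ∧ Irreducible Q ∧
    C = {P : PG2 F | MvPolynomial.eval P.rep Q = 0}

/-- A tangent line to a point set `C`: a line meeting `C` in exactly one point. -/
def IsTangentLine (C l : Set (PG2 F)) : Prop :=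
  IsLine l ∧ (C ∩ l).ncard = 1

/-- A projectivity of `PG2 F`: a map induced by a linear automorphism. -/
def IsProjectivity (φ : PG2 F → PG2 F) : Prop :=
  ∃ g : (Fin 3 → F) ≃ₗ[F] (Fin 3 → F),
    ∀ P : PG2 F, φ P = Projectivization.map g.toLinearMap g.injective P

lemma mk3_ne_zero {a b c : F} (h : a ≠ 0 ∨ b ≠ 0 ∨ c ≠ 0) :
    (![a, b, c] : Fin 3 → F) ≠ 0 := by
  intro hv
  rcases h with h | h | h
  · exact h (by simpa using congrFun hv 0)
  · exact h (by simpa using congrFun hv 1)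
  · exact h (by simpa using congrFun hv 2)

/-- The point of `PG2 F` with homogeneous coordinates `(a, b, c)`. -/
def pt (a b c : F) (h : (![a, b, c] : Fin 3 → F) ≠ 0) : PG2 F :=
  Projectivization.mk F ![a, b, c] h

/-- The linear automorphism `(X₁, X₂, X₃) ↦ (X₁ + a₁·X₃, X₂ + a₂·X₃, X₃)`. -/
def tEquiv (A : F × F) : (Fin 3 → F) ≃ₗ[F] (Fin 3 → F) where
  toFun v := ![v 0 + A.1 * v 2, v 1 + A.2 * v 2, v 2]
  invFun v := ![v 0 - A.1 * v 2, v 1 - A.2 * v 2, v 2]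
  left_inv v := by funext i; fin_cases i <;> simp
  right_inv v := by funext i; fin_cases i <;> simp
  map_add' u v := by funext i; fin_cases i <;> simp <;> ring
  map_smul' c v := by funext i; fin_cases i <;> simp <;> ring

/-- The projectivity `φ_A` of `PG2 F` induced by `tEquiv A`. -/
def tφ (A : F × F) : PG2 F → PG2 F :=
  Projectivization.map (tEquiv A).toLinearMap (tEquiv A).injective

/-- The orbit `K_G(P)` of a point `P` under the translation group `T_G`. -/
def tOrbit (G : AddSubgroup (F × F)) (P : PG2 F) : Set (PG2 F) :=
  {Q : PG2 F | ∃ A ∈ G, Q = tφ A P}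

/-- A translation arc: an arc which is an orbit `K_G(P)`. -/
def IsTranslationArc (K : Set (PG2 F)) : Prop :=
  IsArc K ∧ ∃ (G : AddSubgroup (F × F)) (P : PG2 F), K = tOrbit G P

open Polynomial Lagrange in
/-- If the derivative of `∏ a ∈ X, (T - a)` is constant on `X` and `X` has more than `q / 2`
elements, then `X` is the whole field. -/
lemma card_eq_of_eval_derivative_nodal_const {F : Type*} [Field F] [Fintype F]
    (X : Finset F) (hX : Fintype.card F < 2 * X.card) (c : F)
    (h : ∀ a ∈ X, (derivative (nodal X id)).eval a = c) :
    X.card = Fintype.card F := by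
  classical
  have hpos : 0 < X.card := by omega
  have hg : derivative (nodal X (id : F → F)) = C c := by
    refine Polynomial.eq_of_degrees_lt_of_eval_finset_eq X ?_ ?_ (by simpa using h)
    · refine lt_of_lt_of_le (degree_derivative_lt nodal_ne_zero) ?_
      simp
    · exact lt_of_le_of_lt degree_C_le (by exact_mod_cast hpos)
  have hmul : nodal X (id : F → F) * nodal Xᶜ id =
      Polynomial.X ^ Fintype.card F - Polynomial.X := by
    rw [nodal, nodal, Finset.prod_mul_prod_compl]
    have hdeg := FiniteField.X_pow_card_sub_X_natDegree_eq F (Fintype.one_lt_card (α := F))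
    have hroots := FiniteField.roots_X_pow_card_sub_X F
    have hmonic : (Polynomial.X ^ Fintype.card F - Polynomial.X : F[X]).Monic :=
      monic_X_pow_sub (by rw [degree_X]; exact_mod_cast Fintype.one_lt_card (α := F))
    rw [← prod_multiset_X_sub_C_of_monic_of_roots_card_eq hmonic (by rw [hroots, hdeg]; rfl),
      hroots]
    rfl
  have hder := congrArg derivative hmul
  rw [derivative_mul, hg] at hder
  have hrhs : derivative (Polynomial.X ^ Fintype.card F - Polynomial.X : F[X]) = -1 := by
    simp [derivative_X_pow]
  rw [hrhs] at hder
  have hcard : X.card + Xᶜ.card = Fintype.card F := Finset.card_add_card_compl X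
  by_contra hne
  have hcpos : 0 < Xᶜ.card := by
    have := X.card_le_univ; omega
  have hu : derivative (nodal Xᶜ (id : F → F)) = 0 := by
    by_contra hu
    have h1 : nodal X (id : F → F) * derivative (nodal Xᶜ id) = -1 - C c * nodal Xᶜ id := by
      rw [← hder]; ring
    have h2 := congrArg natDegree h1
    rw [natDegree_mul nodal_ne_zero hu, natDegree_nodal] at h2
    have h3 : (-1 - C c * nodal Xᶜ (id : F → F)).natDegree ≤ Xᶜ.card := by
      refine (natDegree_sub_le _ _).trans (max_le (by simp) ?_)
      exact (natDegree_C_mul_le _ _).trans natDegree_nodal.le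
    omega
  rw [hu, mul_zero, add_zero] at hder
  have hc : c ≠ 0 := by
    rintro rfl
    simp at hder
  have h4 := congrArg natDegree hder
  rw [natDegree_C_mul hc, natDegree_nodal] at h4
  simp at h4
  simp [h4] at hcpos

open Polynomial Lagrange in
/-- A set of more than `q / 2` points of the affine plane, with distinct abscissas, such that from
each of them the others are seen exactly once in each direction of a fixed set `M`, has `q`
points. -/
lemma card_eq_of_common_slopes {F ι : Type*} [Field F] [Fintype F] [DecidableEq F] [DecidableEq ι]
    (K : Finset ι) (x y : ι → F) (M : Finset F) (hx : Set.InjOn x K)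
    (hinj : ∀ A ∈ K, Set.InjOn (fun Q => (y Q - y A) / (x Q - x A)) (K.erase A))
    (hM : ∀ A ∈ K, (K.erase A).image (fun Q => (y Q - y A) / (x Q - x A)) = M)
    (h3 : 3 ≤ K.card) (hK : Fintype.card F < 2 * K.card) :
    K.card = Fintype.card F := by
  have key : ∀ A ∈ K, ∀ B ∈ K, A ≠ B →
      ∏ Q ∈ K.erase A, (x A - x Q) = - ∏ Q ∈ K.erase B, (x B - x Q) := by
    intro A hA B hB hAB
    set m := (y B - y A) / (x B - x A) with hm
    have hxAB : x B - x A ≠ 0 := sub_ne_zero.2 fun h => hAB (hx hB hA h).symm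
    have hprod : ∀ A ∈ K, ∀ B ∈ K, A ≠ B → (y B - y A) / (x B - x A) = m →
        ∏ Q ∈ (K.erase A).erase B, ((y Q - y A) / (x Q - x A) - m) = ∏ s ∈ M.erase m, (s - m) := by
      intro A hA B hB hAB hm
      have hB' : B ∈ K.erase A := Finset.mem_erase.2 ⟨hAB.symm, hB⟩
      have himg : M.erase m =
          ((K.erase A).erase B).image (fun Q => (y Q - y A) / (x Q - x A)) := by
        rw [← hM A hA, ← hm]
        ext s
        simp only [Finset.mem_erase, Finset.mem_image]
        constructor
        · rintro ⟨hs, Q, hQ, rfl⟩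
          exact ⟨Q, ⟨fun h => hs (by rw [h]), hQ⟩, rfl⟩
        · rintro ⟨Q, ⟨hQB, hQ⟩, rfl⟩
          exact ⟨fun h => hQB (hinj A hA (Finset.mem_coe.2 (Finset.mem_erase.2 hQ))
            (Finset.mem_coe.2 hB') h), Q, hQ, rfl⟩
      rw [himg, Finset.prod_image]
      intro P hP Q hQ h
      exact hinj A hA (Finset.mem_coe.2 (Finset.mem_of_mem_erase hP))
        (Finset.mem_coe.2 (Finset.mem_of_mem_erase hQ)) h
    have e1 := hprod A hA B hB hAB rfl
    have e2 := hprod B hB A hA hAB.symm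
      (by rw [hm, ← neg_sub (y B), ← neg_sub (x B), neg_div_neg_eq])
    rw [Finset.erase_right_comm] at e2
    have hne : ∏ s ∈ M.erase m, (s - m) ≠ 0 :=
      Finset.prod_ne_zero_iff.2 fun s hs => sub_ne_zero.2 (Finset.ne_of_mem_erase hs)
    have e3 : ∏ Q ∈ (K.erase A).erase B, (x A - x Q) = ∏ Q ∈ (K.erase A).erase B, (x B - x Q) := by
      apply mul_left_cancel₀ hne
      nth_rewrite 1 [← e1]
      rw [← e2, ← Finset.prod_mul_distrib, ← Finset.prod_mul_distrib]
      refine Finset.prod_congr rfl fun Q hQ => ?_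
      simp only [Finset.mem_erase] at hQ
      have h1 : x Q - x A ≠ 0 := sub_ne_zero.2 fun h => hQ.2.1 (hx hQ.2.2 hA h)
      have h2 : x Q - x B ≠ 0 := sub_ne_zero.2 fun h => hQ.1 (hx hQ.2.2 hB h)
      have h3 : m * (x B - x A) = y B - y A := div_mul_cancel₀ _ hxAB
      have h4 : ((y Q - y A) / (x Q - x A) - m) * (x A - x Q) = -(y Q - y A) + m * (x Q - x A) := by
        field_simp; ring
      have h5 : ((y Q - y B) / (x Q - x B) - m) * (x B - x Q) = -(y Q - y B) + m * (x Q - x B) := by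
        field_simp; ring
      rw [h4, h5]
      linear_combination h3
    rw [← Finset.mul_prod_erase (K.erase A) _ (Finset.mem_erase.2 ⟨hAB.symm, hB⟩),
      ← Finset.mul_prod_erase (K.erase B) _ (Finset.mem_erase.2 ⟨hAB, hA⟩),
      Finset.erase_right_comm (s := K) (a := B), e3]
    ring
  have hconst : ∀ A ∈ K, ∀ B ∈ K, ∏ Q ∈ K.erase A, (x A - x Q) = ∏ Q ∈ K.erase B, (x B - x Q) := by
    intro A hA B hB
    by_cases hAB : A = B
    · rw [hAB]
    obtain ⟨D, hD, hDA, hDB⟩ : ∃ D ∈ K, D ≠ A ∧ D ≠ B := by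
      by_contra! h
      have : K ⊆ {A, B} := fun D hD => by
        by_cases hDA : D = A
        · simp [hDA]
        · simp [h D hD hDA]
      have := (Finset.card_le_card this).trans Finset.card_le_two
      omega
    rw [key A hA D hD hDA.symm, key D hD B hB hDB, neg_neg]
  obtain ⟨A, hA⟩ : K.Nonempty := Finset.card_pos.1 (by omega)
  have hcard : (K.image x).card = K.card := Finset.card_image_of_injOn hx
  rw [← hcard] at hK ⊢
  refine card_eq_of_eval_derivative_nodal_const _ hK (∏ Q ∈ K.erase A, (x A - x Q)) ?_
  intro a ha
  obtain ⟨B, hB, rfl⟩ := Finset.mem_image.1 ha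
  have hnod : nodal (K.image x) id = nodal K x := by
    simp only [nodal]
    exact Finset.prod_image hx
  rw [hnod, eval_nodal_derivative_eval_node_eq hB, eval_nodal, hconst A hA B hB]

lemma apply_rep_mk_eq_zero_iff (f : (Fin 3 → F) →ₗ[F] F) {v : Fin 3 → F} (hv : v ≠ 0) :
    f (Projectivization.mk F v hv).rep = 0 ↔ f v = 0 := by
  obtain ⟨a, ha⟩ := Projectivization.exists_smul_eq_mk_rep F v hv
  rw [← ha, Units.smul_def, map_smul, smul_eq_zero]
  simp

lemma finrank_ker_eq_two {f : (Fin 3 → F) →ₗ[F] F} (hf : f ≠ 0) :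
    Module.finrank F (LinearMap.ker f) = 2 := by
  have h := Module.Dual.finrank_ker_add_one_of_ne_zero (f := f) hf
  rw [Module.finrank_fin_fun] at h
  omega

lemma ker_eq_span_pair {f : (Fin 3 → F) →ₗ[F] F} (hf : f ≠ 0) {P Q : PG2 F} (hPQ : P ≠ Q)
    (hP : f P.rep = 0) (hQ : f Q.rep = 0) :
    LinearMap.ker f = Submodule.span F (Set.range ![P.rep, Q.rep]) := by
  symm
  apply Submodule.eq_of_le_of_finrank_eq
  · rw [Submodule.span_le]
    rintro _ ⟨i, rfl⟩
    fin_cases i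
    · exact hP
    · exact hQ
  · rw [finrank_ker_eq_two hf,
      finrank_span_eq_card (Projectivization.linearIndependent_pair_iff_ne.2 hPQ)]
    simp

lemma IsLine.eq_of_mem {l m : Set (PG2 F)} (hl : IsLine l) (hm : IsLine m) {P Q : PG2 F}
    (hPQ : P ≠ Q) (hPl : P ∈ l) (hQl : Q ∈ l) (hPm : P ∈ m) (hQm : Q ∈ m) : l = m := by
  obtain ⟨f, hf, rfl⟩ := hl
  obtain ⟨g, hg, rfl⟩ := hm
  have h := (ker_eq_span_pair hf hPQ hPl hQl).trans (ker_eq_span_pair hg hPQ hPm hQm).symm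
  ext R
  exact SetLike.ext_iff.1 h R.rep

lemma exists_form_of_ne {P Q : PG2 F} (hPQ : P ≠ Q) :
    ∃ f : (Fin 3 → F) →ₗ[F] F, f ≠ 0 ∧ f P.rep = 0 ∧ f Q.rep = 0 := by
  have h := crossProduct_ne_zero_iff_linearIndependent.2
    (Projectivization.linearIndependent_pair_iff_ne.2 hPQ)
  refine ⟨dotProductBilin F F (crossProduct P.rep Q.rep), ?_, ?_, ?_⟩
  · intro h0
    apply h
    apply dotProduct_eq_zero
    intro w
    exact LinearMap.congr_fun h0 w
  · simp [dotProductBilin, dotProduct_comm]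
  · simp [dotProductBilin, dotProduct_comm]

lemma IsLine.ncard [Fintype F] {l : Set (PG2 F)} (hl : IsLine l) :
    l.ncard = Fintype.card F + 1 := by
  obtain ⟨f, hf, rfl⟩ := hl
  have h := Projectivization.card_of_finrank_two F (LinearMap.ker f) (finrank_ker_eq_two hf)
  rw [Nat.card_eq_fintype_card (α := F)] at h
  rw [← h, ← Set.ncard_univ,
    ← Set.ncard_image_of_injective Set.univ
      (Projectivization.map_injective (LinearMap.ker f).subtype (Submodule.subtype_injective _))]
  congr 1
  ext P
  simp only [Set.mem_ofPred_eq, Set.image_univ, Set.mem_range]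
  constructor
  · intro hP
    refine ⟨Projectivization.mk F ⟨P.rep, hP⟩ fun h => P.rep_nonzero (congrArg Subtype.val h), ?_⟩
    rw [Projectivization.map_mk]
    exact P.mk_rep
  · rintro ⟨R, rfl⟩
    induction R using Projectivization.ind with
    | h v hv =>
      rw [Projectivization.map_mk, apply_rep_mk_eq_zero_iff]
      exact v.2

/-- Completing `K` by the points of `l` off its secants gives an arc, provided that these are at
most two. -/
lemma IsArc.union_diff_focusSet [Fintype F] {K l : Set (PG2 F)} (hK : IsArc K) (hl : IsLine l)
    (hKl : K ∩ l = ∅) (h : (l \ FocusSet K l).ncard ≤ 2) :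
    IsArc (K ∪ (l \ FocusSet K l)) := by
  intro m hm
  by_cases hml : m = l
  · subst hml
    refine (Set.ncard_le_ncard ?_).trans h
    rintro P ⟨hP | hP, hPm⟩
    · exact absurd (show P ∈ K ∩ m from ⟨hP, hPm⟩) (by simp [hKl])
    · exact hP
  rw [Set.union_inter_distrib_right]
  by_cases hs : 2 ≤ (K ∩ m).ncard
  · have : (l \ FocusSet K l) ∩ m = ∅ := by
      ext P
      simp only [Set.mem_inter_iff, Set.mem_sdiff, Set.mem_empty_iff_false, iff_false]
      rintro ⟨⟨hPl, hPF⟩, hPm⟩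
      exact hPF ⟨hPl, m, ⟨hm, hs⟩, hPm⟩
    rw [this, Set.union_empty]
    exact hK m hm
  · have h1 : ((l \ FocusSet K l) ∩ m).ncard ≤ 1 := by
      rw [Set.ncard_le_one]
      rintro P ⟨⟨hPl, -⟩, hPm⟩ Q ⟨⟨hQl, -⟩, hQm⟩
      by_contra hPQ
      exact hml (hm.eq_of_mem hl hPQ hPm hQm hPl hQl)
    have := Set.ncard_union_le (K ∩ m) ((l \ FocusSet K l) ∩ m)
    omega

lemma Hyperfocused.ncard_union_diff_focusSet [Fintype F] {K l : Set (PG2 F)}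
    (h : Hyperfocused K l) (hK : K.Nonempty) :
    (K ∪ (l \ FocusSet K l)).ncard = Fintype.card F + 2 ∧
      (l \ FocusSet K l).ncard + K.ncard = Fintype.card F + 2 := by
  obtain ⟨hl, hKl, hF⟩ := h
  have hsub : FocusSet K l ⊆ l := fun P hP => hP.1
  have h1 := Set.ncard_sdiff_add_ncard_of_subset hsub
  have hpos : 0 < K.ncard := (Set.ncard_pos).2 hK
  rw [hF, hl.ncard] at h1
  rw [Set.ncard_union_eq]
  · omega
  · rw [Set.disjoint_left]
    intro P hP hP'
    exact absurd (show P ∈ K ∩ l from ⟨hP, hP'.1⟩) (by simp [hKl])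

/-- No point of an arc is a linear combination of two other points of it. -/
lemma IsArc.eq_of_smul_add_smul {K : Set (PG2 F)} [Fintype F] (hK : IsArc K) {A B C : PG2 F}
    (hA : A ∈ K) (hB : B ∈ K) (hC : C ∈ K) (hAB : A ≠ B) (hAC : A ≠ C) {α β γ : F} (hγ : γ ≠ 0)
    (h : γ • C.rep = α • A.rep + β • B.rep) : B = C := by
  by_contra hBC
  obtain ⟨f, hf, hfA, hfB⟩ := exists_form_of_ne hAB
  have hfC : f C.rep = 0 := by
    have := congrArg f h
    simpa [hfA, hfB, hγ] using this
  have h3 : ({A, B, C} : Set (PG2 F)).ncard = 3 :=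
    Set.ncard_eq_three.2 ⟨A, B, C, hAB, hAC, hBC, rfl⟩
  have hsub : ({A, B, C} : Set (PG2 F)) ⊆ K ∩ {P | f P.rep = 0} := by
    rintro P (rfl | rfl | rfl)
    · exact ⟨hA, hfA⟩
    · exact ⟨hB, hfB⟩
    · exact ⟨hC, hfC⟩
  have := Set.ncard_le_ncard hsub
  have := hK _ ⟨f, hf, rfl⟩
  omega

/-- A zero of `f` on the chord `AB` is a focus on the line `f = 0`. -/
lemma mk_mem_focusSet [Fintype F] {K : Set (PG2 F)} {f : (Fin 3 → F) →ₗ[F] F}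
    {A B : PG2 F} (hA : A ∈ K) (hB : B ∈ K) (hAB : A ≠ B) {α β : F}
    (hw : α • A.rep + β • B.rep ≠ 0) (hfw : f (α • A.rep + β • B.rep) = 0) :
    Projectivization.mk F (α • A.rep + β • B.rep) hw ∈ FocusSet K {P | f P.rep = 0} := by
  obtain ⟨g, hg, hgA, hgB⟩ := exists_form_of_ne hAB
  refine ⟨(apply_rep_mk_eq_zero_iff f hw).2 hfw, {P | g P.rep = 0}, ⟨⟨g, hg, rfl⟩, ?_⟩, ?_⟩
  · rw [← Set.ncard_pair hAB]
    refine Set.ncard_le_ncard ?_ (Set.toFinite _)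
    rintro P (rfl | rfl)
    · exact ⟨hA, hgA⟩
    · exact ⟨hB, hgB⟩
  · refine (apply_rep_mk_eq_zero_iff g hw).2 ?_
    simp [hgA, hgB]

lemma exists_forms_of_apply_eq_zero {f : (Fin 3 → F) →ₗ[F] F} (hf : f ≠ 0) {c : Fin 3 → F}
    (hc : c ≠ 0) (hfc : f c = 0) :
    ∃ u v : (Fin 3 → F) →ₗ[F] F, u c = 0 ∧ v c = 1 ∧
      ∀ w, u w = 0 → v w = 0 → f w = 0 → w = 0 := by
  obtain ⟨z, hz⟩ := LinearMap.surjective hf 1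
  obtain ⟨i, hi⟩ := Function.ne_iff.1 hc
  rw [Pi.zero_apply] at hi
  refine ⟨dotProductBilin F F (crossProduct c z), (c i)⁻¹ • LinearMap.proj i,
    by simp [dotProductBilin, dotProduct_comm], by simpa using inv_mul_cancel₀ hi, ?_⟩
  intro w hu hv hfw
  have hdet : Matrix.det ![w, c, z] = 0 := by
    rw [← triple_product_eq_det, dotProduct_comm]
    exact hu
  obtain ⟨a, ha, h⟩ := Matrix.exists_vecMul_eq_zero_iff.2 hdet
  have h' : a 0 • w + a 1 • c + a 2 • z = 0 := by
    rw [← h]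
    ext j
    simp [Matrix.vecMul, dotProduct, Fin.sum_univ_three]
  have h2 : a 2 = 0 := by simpa [hfw, hfc, hz] using congrArg f h'
  have hw : w i = 0 := by simpa [hi] using hv
  have h1 : a 1 = 0 := by simpa [hw, h2, hi] using congrFun h' i
  have h0 : a 0 ≠ 0 := by
    intro h0
    apply ha
    ext j
    fin_cases j <;> simp [h0, h1, h2]
  simpa [h1, h2, h0] using h'

/-- a hyperfocused `k`-arc (`k ≥ 4`) not contained in a hyperoval
(a `(q+2)`-arc) satisfies `k ≤ q / 2`. -/
theorem hyperfocused_not_in_hyperoval_le {F : Type*} [Field F] [Fintype F]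
    (k : ℕ) (hk : 4 ≤ k) (K l : Set (PG2 F)) (harc : IsArc K)
    (hcard : K.ncard = k) (hhf : Hyperfocused K l)
    (hno : ¬ ∃ O : Set (PG2 F), IsArc O ∧ O.ncard = Fintype.card F + 2 ∧ K ⊆ O) :
    k ≤ Fintype.card F / 2 := by
  classical
  by_contra hlt
  have hKne : K.Nonempty := (Set.ncard_pos).1 (by omega)
  obtain ⟨hO, hS⟩ := hhf.ncard_union_diff_focusSet hKne
  have h3 : 2 < (l \ FocusSet K l).ncard := by
    by_contra h
    exact hno ⟨_, harc.union_diff_focusSet hhf.1 hhf.2.1 (by omega), hO, Set.subset_union_left⟩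
  obtain ⟨C, hCl, hCF⟩ : (l \ FocusSet K l).Nonempty := (Set.ncard_pos).1 (by omega)
  obtain ⟨⟨f, hf, rfl⟩, hKl, hF⟩ := hhf
  obtain ⟨u, v, huc, hvc, huv⟩ := exists_forms_of_apply_eq_zero hf C.rep_nonzero hCl
  have hfK : ∀ P ∈ K, f P.rep ≠ 0 := fun P hP h =>
    absurd (show P ∈ K ∩ {P | f P.rep = 0} from ⟨hP, h⟩) (by simp [hKl])
  -- the direction of the chord `AQ`
  let d : PG2 F → PG2 F → Fin 3 → F := fun A Q => (-(f A.rep)⁻¹) • A.rep + (f Q.rep)⁻¹ • Q.rep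
  let x : PG2 F → F := fun P => u P.rep / f P.rep
  let y : PG2 F → F := fun P => v P.rep / f P.rep
  have hdu : ∀ A Q, u (d A Q) = x Q - x A := fun A Q => by simp [d, x]; ring
  have hdv : ∀ A Q, v (d A Q) = y Q - y A := fun A Q => by simp [d, y]; ring
  have hdf : ∀ A ∈ K, ∀ Q ∈ K, f (d A Q) = 0 := fun A hA Q hQ => by
    simp [d, hfK A hA, hfK Q hQ]
  have hd0 : ∀ A ∈ K, ∀ Q ∈ K, A ≠ Q → d A Q ≠ 0 := fun A hA Q hQ hAQ h => by
    have := (LinearIndependent.pair_iff.1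
      (Projectivization.linearIndependent_pair_iff_ne.2 hAQ) _ _ h).2
    exact hfK Q hQ (inv_eq_zero.1 this)
  have hdF : ∀ A (hA : A ∈ K) Q (hQ : Q ∈ K) (hAQ : A ≠ Q),
      Projectivization.mk F (d A Q) (hd0 A hA Q hQ hAQ) ∈ FocusSet K {P | f P.rep = 0} :=
    fun A hA Q hQ hAQ => mk_mem_focusSet hA hQ hAQ _ (hdf A hA Q hQ)
  have hx : ∀ A ∈ K, ∀ Q ∈ K, A ≠ Q → x Q - x A ≠ 0 := by
    intro A hA Q hQ hAQ h
    have hw : d A Q - v (d A Q) • C.rep = 0 := by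
      apply huv
      · simp [hdu, h, huc]
      · simp [hvc]
      · rw [map_sub, hdf A hA Q hQ, map_smul, show f C.rep = 0 from hCl, smul_zero, sub_zero]
    apply hCF
    convert hdF A hA Q hQ hAQ
    conv_lhs => rw [← C.mk_rep]
    symm
    rw [Projectivization.mk_eq_mk_iff']
    exact ⟨v (d A Q), (sub_eq_zero.1 hw).symm⟩
  have hinj : ∀ A ∈ K, ∀ P ∈ K, ∀ Q ∈ K, A ≠ P → A ≠ Q →
      (y P - y A) / (x P - x A) = (y Q - y A) / (x Q - x A) → P = Q := by
    intro A hA P hP Q hQ hAP hAQ h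
    rw [div_eq_div_iff (hx A hA P hP hAP) (hx A hA Q hQ hAQ)] at h
    have hw : (x P - x A) • d A Q - (x Q - x A) • d A P = 0 := by
      apply huv
      · simp only [map_sub, map_smul, hdu, smul_eq_mul]; ring
      · simp only [map_sub, map_smul, hdv, smul_eq_mul]; linear_combination -h
      · simp [hdf A hA P hP, hdf A hA Q hQ]
    refine harc.eq_of_smul_add_smul hA hP hQ hAP hAQ
      (α := (x P - x A) * (f A.rep)⁻¹ - (x Q - x A) * (f A.rep)⁻¹)
      (β := (x Q - x A) * (f P.rep)⁻¹) (γ := (x P - x A) * (f Q.rep)⁻¹)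
      (mul_ne_zero (hx A hA P hP hAP) (inv_ne_zero (hfK Q hQ))) ?_
    rw [← sub_eq_zero, ← hw]
    simp only [d]
    module
  have hKfin : K.Finite := K.toFinite
  let M : Finset F := (Set.toFinite (FocusSet K {P | f P.rep = 0})).toFinset.image
    fun D => v D.rep / u D.rep
  have hKc : hKfin.toFinset.card = k := by rw [← hcard, Set.ncard_eq_toFinset_card K hKfin]
  have hMc : M.card ≤ k - 1 := by
    refine Finset.card_image_le.trans ?_
    rw [← Set.ncard_eq_toFinset_card, hF, hcard]
  have hinj' : ∀ A ∈ hKfin.toFinset,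
      Set.InjOn (fun Q => (y Q - y A) / (x Q - x A)) (hKfin.toFinset.erase A) := by
    intro A hA P hP Q hQ h
    simp only [Finset.coe_erase, Set.Finite.coe_toFinset, Set.mem_sdiff, Set.mem_singleton_iff,
      Set.Finite.mem_toFinset] at hA hP hQ
    exact hinj A hA P hP.1 Q hQ.1 (Ne.symm hP.2) (Ne.symm hQ.2) h
  have hfinal := card_eq_of_common_slopes hKfin.toFinset x y M ?_ hinj' ?_ (by omega) (by omega)
  · omega
  · intro P hP Q hQ h
    by_contra hPQ
    exact hx P (by simpa using hP) Q (by simpa using hQ) hPQ (sub_eq_zero.2 h.symm)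
  · intro A hA
    apply Finset.eq_of_subset_of_card_le
    · intro s hs
      obtain ⟨Q, hQ, rfl⟩ := Finset.mem_image.1 hs
      simp only [Finset.mem_erase, Set.Finite.mem_toFinset] at hA hQ
      refine Finset.mem_image.2 ⟨_, (Set.Finite.mem_toFinset _).2
        (hdF A hA Q hQ.2 (Ne.symm hQ.1)), ?_⟩
      obtain ⟨a, ha⟩ := Projectivization.exists_smul_eq_mk_rep F _
        (hd0 A hA Q hQ.2 (Ne.symm hQ.1))
      rw [← ha, Units.smul_def, map_smul, map_smul, hdu, hdv, smul_eq_mul, smul_eq_mul,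
        mul_div_mul_left _ _ a.ne_zero]
    · rw [Finset.card_image_of_injOn (hinj' A hA), Finset.card_erase_of_mem hA, hKc]
      exact hMc
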